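/- Let m, n_yq, k be natural numbers with n_yq ≤ m and Θ_w = diag_m(J). Let D_q be a real 2n_yq×2m matrix and D'_q a real (2m−2n_yq)×2m matrix such that the stacked matrix V = [D_q; D'_q] satisfies V·Θ_w·Vᵀ = Θ_w. If a real k×2m matrix M satisfies M·Θ_w·D_qᵀ = 0, then there exists a real k×(2m−2n_yq) matrix X such that X·D'_q = M. -/

import Mathlib

open Matrix

/-- The 2×2 real matrix `J = [[0,1],[-1,0]]`. -/
def Jmat : Matrix (Fin 2) (Fin 2) ℝ := !![0, 1; -1, 0]

/-- `diagJ k` is the `2k × 2k` block-diagonal real matrix with `k` copies of `J`. -/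
def diagJ (k : ℕ) : Matrix (Fin (2 * k)) (Fin (2 * k)) ℝ :=
  Matrix.of fun i j =>
    if i.val / 2 = j.val / 2 then
      Jmat ⟨i.val % 2, Nat.mod_lt _ two_pos⟩ ⟨j.val % 2, Nat.mod_lt _ two_pos⟩
    else 0

theorem diagJ_mul_self (m : ℕ) : diagJ m * diagJ m = -1 := by
  ext i j
  rw [Matrix.mul_apply, Finset.sum_eq_single
    (⟨2 * (i.val / 2) + (1 - i.val % 2), by omega⟩ : Fin (2 * m))]
  · rcases Nat.mod_two_eq_zero_or_one i.val with hi | hi <;>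
    rcases Nat.mod_two_eq_zero_or_one j.val with hj | hj <;>
    by_cases h : i.val / 2 = j.val / 2 <;>
    simp [diagJ, Jmat, hi, hj, Matrix.one_apply, Fin.ext_iff, Nat.add_mod, Nat.add_div, h] <;>
    omega
  · intro l _ hl
    rw [ne_eq, Fin.ext_iff] at hl
    by_cases h : i.val / 2 = l.val / 2
    · rcases Nat.mod_two_eq_zero_or_one i.val with hi | hi <;>
      rcases Nat.mod_two_eq_zero_or_one l.val with hl' | hl' <;>
      first
      | (simp only [hi] at hl; omega)
      | simp [diagJ, Jmat, hi, hl']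
    · simp [diagJ, h]
  · simp

theorem diagJ_apply_of_div_ne {m : ℕ} {i j : Fin (2 * m)} (h : i.val / 2 ≠ j.val / 2) :
    diagJ m i j = 0 := by
  simp [diagJ, h]

/-- If `V P = 1` with `V = [A; B]`, where the index type of the rows of `V` is equivalent to that
of its columns, and `M P` vanishes on the columns indexed by the rows of `A`, then `M` factors
through `B`. -/
theorem exists_mul_eq_of_fromRows_mul_eq_one {R ι a b n : Type*} [CommRing R]
    [Fintype a] [Fintype b] [Fintype n] [DecidableEq a] [DecidableEq b] [DecidableEq n]
    (e : a ⊕ b ≃ n) {A : Matrix a n R} {B : Matrix b n R} {P : Matrix n (a ⊕ b) R}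
    (h : fromRows A B * P = 1) {M : Matrix ι n R} (hM : (M * P).toCols₁ = 0) :
    ∃ X : Matrix ι b R, X * B = M := by
  have hP : P * fromRows A B = 1 := (mul_eq_one_comm_of_equiv e).1 h
  refine ⟨(M * P).toCols₂, ?_⟩
  calc (M * P).toCols₂ * B
      = fromCols (M * P).toCols₁ (M * P).toCols₂ * fromRows A B := by
        rw [fromCols_mul_fromRows, hM, Matrix.zero_mul, zero_add]
    _ = M := by rw [fromCols_toCols, Matrix.mul_assoc, hP, Matrix.mul_one]

/-- If `[D_q; D'_q]` is symplectic and `M Θ_w D_qᵀ = 0`, then `M` factors through `D'_q`. -/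
theorem factor_through_auxiliary_output (m n_yq k : ℕ) (hyq : n_yq ≤ m)
    (Dq : Matrix (Fin (2 * n_yq)) (Fin (2 * m)) ℝ)
    (Dq' : Matrix (Fin (2 * m - 2 * n_yq)) (Fin (2 * m)) ℝ)
    (hV : Matrix.fromRows Dq Dq' * diagJ m * (Matrix.fromRows Dq Dq')ᵀ =
        (diagJ m).submatrix
          (finSumFinEquiv.trans (finCongr (by omega : 2 * n_yq + (2 * m - 2 * n_yq) = 2 * m)))
          (finSumFinEquiv.trans (finCongr (by omega : 2 * n_yq + (2 * m - 2 * n_yq) = 2 * m))))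
    (M : Matrix (Fin k) (Fin (2 * m)) ℝ)
    (hM : M * diagJ m * Dqᵀ = 0) :
    ∃ X : Matrix (Fin k) (Fin (2 * m - 2 * n_yq)) ℝ, X * Dq' = M := by
  set e := finSumFinEquiv.trans
    (finCongr (by omega : 2 * n_yq + (2 * m - 2 * n_yq) = 2 * m)) with he
  set S := (diagJ m).submatrix e e with hS
  have hSS : S * S = -1 := by
    rw [hS, submatrix_mul_equiv, diagJ_mul_self, submatrix_neg, Pi.neg_apply, Pi.neg_apply,
      submatrix_one_equiv]
  have hS₂₁ (i j) : S (Sum.inr i) (Sum.inl j) = 0 := by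
    refine diagJ_apply_of_div_ne ?_
    simp [he]
    omega
  refine exists_mul_eq_of_fromRows_mul_eq_one e (A := Dq)
    (P := diagJ m * (fromRows Dq Dq')ᵀ * -S) ?_ ?_
  · rw [← Matrix.mul_assoc, ← Matrix.mul_assoc, hV, Matrix.mul_neg, hSS, neg_neg]
  · ext i j
    have hM' (l) : (M * diagJ m * (fromRows Dq Dq')ᵀ) i (Sum.inl l) = 0 :=
      congrFun (congrFun hM i) l
    rw [toCols₁_apply, ← Matrix.mul_assoc, ← Matrix.mul_assoc, Matrix.mul_apply,
      Fintype.sum_sum_type]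
    simp [hM', hS₂₁]
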